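/- Let Θ : g → g be a Lie algebra automorphism with Θ² = id and Θ(t) = −t for all t ∈ h (a Chevalley involution), let V be a finite-dimensional g-module and Θ_V : V → V a linear map with Θ_V² = id and Θ_V(x·v) = Θ(x)·Θ_V(v) for all x ∈ g, v ∈ V. Then Θ_V maps the zero weight space V[0] to itself and commutes with the action on V of every truncated Casimir κ_α (α ∈ R). Consequently, if V[0] ≠ 0 and the restriction of Θ_V to V[0] is not a scalar multiple of the identity, then V[0] is reducible under the Casimir algebra C(g). -/

import Mathlib

open LieAlgebra UniversalEnvelopingAlgebra

/-- `x` is a root vector for the functional `α` on the Cartan subalgebra `H`. -/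
def IsRootVector {L : Type} [LieRing L] [LieAlgebra ℂ L] (H : LieSubalgebra ℂ L)
    (α : Module.Dual ℂ H) (x : L) : Prop :=
  ∀ t : H, ⁅(t : L), x⁆ = α t • x

section RootVectors

variable {L : Type} [LieRing L] [LieAlgebra ℂ L] {H : LieSubalgebra ℂ L}

/-- In a semisimple Lie algebra, two root vectors for the same root are proportional. -/
theorem IsRootVector.exists_eq_smul [FiniteDimensional ℂ L] [LieAlgebra.IsSemisimple ℂ L]
    [H.IsCartanSubalgebra] {α : Module.Dual ℂ H} (hα : α ≠ 0) {x y : L}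
    (hx : IsRootVector H α x) (hx0 : x ≠ 0) (hy : IsRootVector H α y) : ∃ a : ℂ, y = a • x := by
  have hmem : ∀ z : L, IsRootVector H α z → z ∈ rootSpace H (α : H → ℂ) := fun z hz ↦
    LieModule.weightSpace_le_genWeightSpace L _ ((LieModule.mem_weightSpace _ _).2 hz)
  have hne : rootSpace H (α : H → ℂ) ≠ ⊥ := fun h ↦ hx0 (by simpa [h] using hmem x hx)
  let w : LieModule.Weight ℂ H L := ⟨α, hne⟩
  have hw : w.IsNonZero := fun h ↦ hα (DFunLike.coe_injective h)
  have h1 : Module.finrank ℂ (rootSpace H w) = 1 := IsKilling.finrank_rootSpace_eq_one w hw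
  obtain ⟨a, ha⟩ := (finrank_eq_one_iff_of_nonzero' (⟨x, hmem x hx⟩ : rootSpace H w)
    (by simpa [LieSubmodule.mk_eq_zero] using hx0)).1 h1 ⟨y, hmem y hy⟩
  exact ⟨a, (congrArg Subtype.val ha).symm⟩

/-- A Chevalley involution maps root vectors for `α` to root vectors for `-α`. -/
theorem IsRootVector.map_chevalley {α : Module.Dual ℂ H} {x : L} (hx : IsRootVector H α x)
    {Θ : L →ₗ⁅ℂ⁆ L} (hΘH : ∀ s : H, Θ s = -(s : L)) : IsRootVector H (-α) (Θ x) := by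
  intro s
  have h := congrArg Θ (hx s)
  rw [LieHom.map_lie, hΘH, map_smul, neg_lie, neg_eq_iff_eq_neg] at h
  rw [h, LinearMap.neg_apply, neg_smul]

/-- The product of root vectors for opposite roots preserves the zero weight space. -/
theorem IsRootVector.lie_lie_lie_eq_zero {V : Type} [AddCommGroup V] [Module ℂ V]
    [LieRingModule L V] [LieModule ℂ L V] {α : Module.Dual ℂ H} {x y : L}
    (hx : IsRootVector H α x) (hy : IsRootVector H (-α) y) {v : V}
    (hv : ∀ s : H, ⁅(s : L), v⁆ = 0) (s : H) : ⁅(s : L), ⁅x, ⁅y, v⁆⁆⁆ = 0 := by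
  rw [leibniz_lie (s : L) x, leibniz_lie (s : L) y, hx s, hy s, hv s]
  simp

/-- The symmetrized product of opposite root vectors is fixed by a Chevalley involution. -/
theorem IsRootVector.lie_lie_add_lie_lie_chevalley [FiniteDimensional ℂ L]
    [LieAlgebra.IsSemisimple ℂ L] [H.IsCartanSubalgebra] {V : Type} [AddCommGroup V] [Module ℂ V]
    [LieRingModule L V] [LieModule ℂ L V] {α : Module.Dual ℂ H} (hα : α ≠ 0) {x y : L}
    (hx : IsRootVector H α x) (hx0 : x ≠ 0) (hy : IsRootVector H (-α) y) (hy0 : y ≠ 0)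
    {Θ : L →ₗ⁅ℂ⁆ L} (hΘ2 : ∀ z, Θ (Θ z) = z) (hΘH : ∀ s : H, Θ s = -(s : L)) (v : V) :
    ⁅Θ x, ⁅Θ y, v⁆⁆ + ⁅Θ y, ⁅Θ x, v⁆⁆ = ⁅x, ⁅y, v⁆⁆ + ⁅y, ⁅x, v⁆⁆ := by
  obtain ⟨a, ha⟩ := hy.exists_eq_smul (neg_ne_zero.2 hα) hy0 (hx.map_chevalley hΘH)
  have hy' := hy.map_chevalley hΘH
  rw [neg_neg] at hy'
  obtain ⟨b, hb⟩ := hx.exists_eq_smul hα hx0 hy'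
  have hab : a * b = 1 := by
    have h := hΘ2 x
    rw [ha, map_smul, hb, smul_smul] at h
    exact smul_left_injective ℂ hx0 (h.trans (one_smul ℂ x).symm)
  have hba : b * a = 1 := by rw [mul_comm, hab]
  simp only [ha, hb, smul_lie, lie_smul, smul_smul, hab, hba, one_smul]
  exact add_comm _ _

end RootVectors

/-- a Chevalley involution `Θ_V` of a `g`-module `V` preserves the zero weight
space `V[0]`, commutes there with all truncated Casimirs, and if it is not a scalar on
`V[0] ≠ 0` then `V[0]` is reducible under the Casimir algebra `C(g)`. -/
theorem chevalley_involution_reducibility_criterion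
    {L : Type} [LieRing L] [LieAlgebra ℂ L] [FiniteDimensional ℂ L]
    [LieAlgebra.IsSemisimple ℂ L]
    (H : LieSubalgebra ℂ L) [H.IsCartanSubalgebra]
    (c : ℂ) (hc : c ≠ 0)
    (B : LinearMap.BilinForm ℂ L) (hB : B = c • killingForm ℂ L)
    (R : Set (Module.Dual ℂ H))
    (hR : R = {α | α ≠ 0 ∧ ∃ x : L, x ≠ 0 ∧ IsRootVector H α x})
    (t : Module.Dual ℂ H → H)
    (ht : ∀ α ∈ R, ∀ x : H, B (t α) x = α x)
    (e f : Module.Dual ℂ H → L) (hcoroot : Module.Dual ℂ H → H)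
    (he : ∀ α ∈ R, IsRootVector H α (e α) ∧ e α ≠ 0)
    (hf : ∀ α ∈ R, IsRootVector H (-α) (f α) ∧ f α ≠ 0)
    (hef : ∀ α ∈ R, ⁅e α, f α⁆ = (hcoroot α : L))
    (hcoroot2 : ∀ α ∈ R, α (hcoroot α) = 2)
    (κ : Module.Dual ℂ H → UniversalEnvelopingAlgebra ℂ L)
    (hκ : ∀ α ∈ R, κ α = (B (t α) (t α) / 2) •
      (ι ℂ (e α) * ι ℂ (f α) + ι ℂ (f α) * ι ℂ (e α)))
    -- a Chevalley involution of `g`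
    (Θ : L →ₗ⁅ℂ⁆ L) (hΘ2 : ∀ x, Θ (Θ x) = x) (hΘH : ∀ s : H, Θ s = -(s : L))
    -- a finite-dimensional `g`-module `V` with compatible involution `Θ_V`
    {V : Type} [AddCommGroup V] [Module ℂ V] [LieRingModule L V] [LieModule ℂ L V]
    [FiniteDimensional ℂ V]
    (ΘV : V →ₗ[ℂ] V) (hΘV2 : ∀ v, ΘV (ΘV v) = v)
    (hΘVequiv : ∀ (x : L) (v : V), ΘV ⁅x, v⁆ = ⁅Θ x, ΘV v⁆)
    -- the action of `U(g)` on `V`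
    (ρ : UniversalEnvelopingAlgebra ℂ L →ₐ[ℂ] Module.End ℂ V)
    (hρ : ρ = (UniversalEnvelopingAlgebra.lift ℂ) (LieModule.toEnd ℂ L V)) :
    -- `Θ_V` preserves the zero weight space
    (∀ v : V, (∀ s : H, ⁅(s : L), v⁆ = 0) → ∀ s : H, ⁅(s : L), ΘV v⁆ = 0) ∧
    -- `Θ_V` commutes with the action of every truncated Casimir
    (∀ α ∈ R, ∀ v : V, ΘV (ρ (κ α) v) = ρ (κ α) (ΘV v)) ∧
    -- the reducibility criterion
    ((∃ v : V, v ≠ 0 ∧ ∀ s : H, ⁅(s : L), v⁆ = 0) →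
      (¬∃ z : ℂ, ∀ v : V, (∀ s : H, ⁅(s : L), v⁆ = 0) → ΘV v = z • v) →
      ∃ U : Submodule ℂ V,
        (∀ v ∈ U, ∀ s : H, ⁅(s : L), v⁆ = 0) ∧
        (∀ x ∈ Algebra.adjoin ℂ
            ((ι ℂ '' (H : Set L)) ∪ (κ '' R)), ∀ v ∈ U, ρ x v ∈ U) ∧
        U ≠ ⊥ ∧ ∃ w : V, (∀ s : H, ⁅(s : L), w⁆ = 0) ∧ w ∉ U) := by
  have hι : ∀ (x : L) (v : V), ρ (ι ℂ x) v = ⁅x, v⁆ := fun x v ↦ by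
    rw [hρ, UniversalEnvelopingAlgebra.lift_ι_apply, LieModule.toEnd_apply_apply]
  have hκv : ∀ α ∈ R, ∀ v : V, ρ (κ α) v =
      (B (t α) (t α) / 2) • (⁅e α, ⁅f α, v⁆⁆ + ⁅f α, ⁅e α, v⁆⁆) := fun α hα v ↦ by
    simp only [hκ α hα, map_smul, map_add, map_mul, LinearMap.smul_apply, LinearMap.add_apply,
      Module.End.mul_apply, hι]
  have hzero : ∀ v : V, (∀ s : H, ⁅(s : L), v⁆ = 0) → ∀ s : H, ⁅(s : L), ΘV v⁆ = 0 := by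
    intro v hv s
    have h := hΘVequiv s v
    rwa [hv s, map_zero, hΘH, neg_lie, eq_comm, neg_eq_zero] at h
  have hcomm : ∀ α ∈ R, ∀ v : V, ΘV (ρ (κ α) v) = ρ (κ α) (ΘV v) := by
    intro α hα v
    have hα0 : α ≠ 0 := (hR ▸ hα).1
    rw [hκv α hα, hκv α hα, map_smul, map_add, hΘVequiv, hΘVequiv, hΘVequiv, hΘVequiv,
      (he α hα).1.lie_lie_add_lie_lie_chevalley hα0 (he α hα).2 (hf α hα).1 (hf α hα).2 hΘ2 hΘH]
  refine ⟨hzero, hcomm, fun _ hscalar ↦ ?_⟩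
  let U : Submodule ℂ V :=
    { carrier := {v | (∀ s : H, ⁅(s : L), v⁆ = 0) ∧ ΘV v = v}
      add_mem' := fun {v w} hv hw ↦
        ⟨fun s ↦ by rw [lie_add, hv.1, hw.1, add_zero], by rw [map_add, hv.2, hw.2]⟩
      zero_mem' := ⟨fun s ↦ lie_zero _, map_zero _⟩
      smul_mem' := fun z v hv ↦
        ⟨fun s ↦ by rw [lie_smul, hv.1, smul_zero], by rw [map_smul, hv.2]⟩ }
  refine ⟨U, fun v hv ↦ hv.1, fun x hx ↦ ?_, fun hbot ↦ hscalar ⟨-1, fun v hv ↦ ?_⟩, ?_⟩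
  · induction hx using Algebra.adjoin_induction with
    | mem x hx =>
      intro v hv
      rcases hx with ⟨s, hs, rfl⟩ | ⟨α, hα, rfl⟩
      · rw [hι, hv.1 ⟨s, hs⟩]
        exact U.zero_mem
      · refine ⟨fun s ↦ ?_, by rw [hcomm α hα, hv.2]⟩
        have hfe : ⁅(s : L), ⁅f α, ⁅e α, v⁆⁆⁆ = 0 :=
          (hf α hα).1.lie_lie_lie_eq_zero (by rw [neg_neg]; exact (he α hα).1) hv.1 s
        rw [hκv α hα, lie_smul, lie_add,
          (he α hα).1.lie_lie_lie_eq_zero (hf α hα).1 hv.1 s, hfe, add_zero, smul_zero]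
    | algebraMap z =>
      intro v hv
      rw [AlgHom.commutes, Module.algebraMap_end_apply]
      exact U.smul_mem z hv
    | add x y _ _ hx hy =>
      intro v hv
      rw [map_add, LinearMap.add_apply]
      exact U.add_mem (hx v hv) (hy v hv)
    | mul x y _ _ hx hy =>
      intro v hv
      rw [map_mul, Module.End.mul_apply]
      exact hx _ (hy v hv)
  · have hmem : ΘV v + v ∈ U :=
      ⟨fun s ↦ by rw [lie_add, hzero v hv, hv, add_zero], by rw [map_add, hΘV2, add_comm]⟩
    rw [hbot, Submodule.mem_bot] at hmem
    rw [neg_one_smul, eq_neg_of_add_eq_zero_left hmem]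
  · by_contra! hall
    exact hscalar ⟨1, fun v hv ↦ by rw [one_smul, (hall v hv).2]⟩
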